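/- arXiv:2402.06017 — 2 statements merged into one kernel-verified Lean document; each statement's English description precedes it below -/
import Mathlib

section
/- Let G be a group and let x_1, …, x_10 ∈ G satisfy: x_i² = e for i = 1,…,10; (x_i x_j)³ = e for each pair {i,j} ∈ {{1,2},{1,4},{2,3},{3,5},{4,6},{5,10},{6,7},{7,8},{8,9},{9,10}}; (x_5 · x_10 x_9 x_10)³ = e; (x_5 · x_10 x_9 x_10 x_8 x_10 x_9 x_10)³ = e; (x_5 · x_10 x_9 x_10 x_8 x_10 x_9 x_10 x_7 x_10 x_9 x_10 x_8 x_10 x_9 x_10)³ = e; x_4 x_3 x_2 x_1 x_2 x_3 x_4 = x_6 x_7 x_10 x_9 x_10 x_8 x_10 x_9 x_10 x_7 x_5 x_7 x_10 x_9 x_10 x_8 x_10 x_9 x_10 x_7 x_6; and (x_i x_j)² = e for each pair {i,j} ∈ {{1,3},{1,5},{1,6},{1,7},{1,8},{1,9},{1,10},{2,6},{2,7},{2,8},{2,9},{2,10},{3,4},{3,6},{3,7},{3,8},{3,9},{3,10},{4,8},{4,9},{4,10},{5,6},{6,8},{6,9},{6,10},{7,9},{7,10},{8,10}}. Then x_2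 commutes with x_4, i.e., (x_2 x_4)² = e. -/
theorem commute_of_mul_sq_eq_one {G : Type*} [Group G] {a b : G}
    (ha : a ^ 2 = 1) (hb : b ^ 2 = 1) (h : (a * b) ^ 2 = 1) : Commute a b := by
  have ha' : a⁻¹ = a := inv_eq_of_mul_eq_one_left (by rw [← sq, ha])
  have hb' : b⁻¹ = b := inv_eq_of_mul_eq_one_left (by rw [← sq, hb])
  have hab : (a * b)⁻¹ = a * b := inv_eq_of_mul_eq_one_left (by rw [← sq, h])
  rw [mul_inv_rev, ha', hb'] at hab
  exact hab.symm

theorem braid_of_mul_pow_three_eq_one {G : Type*} [Group G] {a b : G}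
    (ha : a ^ 2 = 1) (hb : b ^ 2 = 1) (h : (a * b) ^ 3 = 1) : a * b * a = b * a * b := by
  have ha' : a⁻¹ = a := inv_eq_of_mul_eq_one_left (by rw [← sq, ha])
  have hb' : b⁻¹ = b := inv_eq_of_mul_eq_one_left (by rw [← sq, hb])
  have hab : (b * a * b)⁻¹ = a * b * a :=
    inv_eq_of_mul_eq_one_left (by rw [← h]; simp only [pow_succ, pow_zero, one_mul, mul_assoc])
  rw [← hab]
  simp only [mul_inv_rev, ha', hb', mul_assoc]

/-- If the involutions `a` and `b` satisfy the braid relation and `b` commutes with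
`a * b * l * b * a`, then `a` commutes with `l`. -/
theorem commute_of_commute_braid_conj {G : Type*} [Group G] {a b l : G}
    (ha : a ^ 2 = 1) (hb : b ^ 2 = 1) (hab : a * b * a = b * a * b)
    (h : Commute b (a * b * l * b * a)) : Commute a l := by
  have ha' : a⁻¹ = a := inv_eq_of_mul_eq_one_left (by rw [← sq, ha])
  have hb' : b⁻¹ = b := inv_eq_of_mul_eq_one_left (by rw [← sq, hb])
  have hinv : (a * b)⁻¹ = b * a := by rw [mul_inv_rev, ha', hb']
  have hba : a * b * a * (a * b)⁻¹ = b := by rw [hab, hinv, mul_assoc (b * a), ← mul_assoc b b,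
    ← sq b, hb, one_mul, mul_assoc, ← sq, ha, mul_one]
  have hl : a * b * l * b * a = a * b * l * (a * b)⁻¹ := by rw [hinv, ← mul_assoc]
  exact (Commute.conj_iff (a * b)).mp (by rwa [hba, ← hl])

theorem zappatic_E10_x2_comm_x4 {G : Type*} [Group G]
    (x1 x2 x3 x4 x5 x6 x7 x8 x9 x10 : G)
    (h1 : x1 ^ 2 = 1) (h2 : x2 ^ 2 = 1) (h3 : x3 ^ 2 = 1) (h4 : x4 ^ 2 = 1)
    (h5 : x5 ^ 2 = 1) (h6 : x6 ^ 2 = 1) (h7 : x7 ^ 2 = 1) (h8 : x8 ^ 2 = 1)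
    (h9 : x9 ^ 2 = 1) (h10 : x10 ^ 2 = 1)
    (b12 : (x1 * x2) ^ 3 = 1) (b14 : (x1 * x4) ^ 3 = 1) (b23 : (x2 * x3) ^ 3 = 1)
    (b35 : (x3 * x5) ^ 3 = 1) (b46 : (x4 * x6) ^ 3 = 1) (b5_10 : (x5 * x10) ^ 3 = 1)
    (b67 : (x6 * x7) ^ 3 = 1) (b78 : (x7 * x8) ^ 3 = 1) (b89 : (x8 * x9) ^ 3 = 1)
    (b9_10 : (x9 * x10) ^ 3 = 1)
    (blong1 : (x5 * (x10 * x9 * x10)) ^ 3 = 1)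
    (blong2 : (x5 * (x10 * x9 * x10 * x8 * x10 * x9 * x10)) ^ 3 = 1)
    (blong3 : (x5 * (x10 * x9 * x10 * x8 * x10 * x9 * x10 * x7 *
        x10 * x9 * x10 * x8 * x10 * x9 * x10)) ^ 3 = 1)
    (hstar : x4 * x3 * x2 * x1 * x2 * x3 * x4 =
      x6 * x7 * x10 * x9 * x10 * x8 * x10 * x9 * x10 * x7 *
        x5 * x7 * x10 * x9 * x10 * x8 * x10 * x9 * x10 * x7 * x6)
    (c13 : (x1 * x3) ^ 2 = 1) (c15 : (x1 * x5) ^ 2 = 1) (c16 : (x1 * x6) ^ 2 = 1)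
    (c17 : (x1 * x7) ^ 2 = 1) (c18 : (x1 * x8) ^ 2 = 1) (c19 : (x1 * x9) ^ 2 = 1)
    (c1_10 : (x1 * x10) ^ 2 = 1)
    (c26 : (x2 * x6) ^ 2 = 1) (c27 : (x2 * x7) ^ 2 = 1) (c28 : (x2 * x8) ^ 2 = 1)
    (c29 : (x2 * x9) ^ 2 = 1) (c2_10 : (x2 * x10) ^ 2 = 1)
    (c34 : (x3 * x4) ^ 2 = 1) (c36 : (x3 * x6) ^ 2 = 1) (c37 : (x3 * x7) ^ 2 = 1)
    (c38 : (x3 * x8) ^ 2 = 1) (c39 : (x3 * x9) ^ 2 = 1) (c3_10 : (x3 * x10) ^ 2 = 1)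
    (c48 : (x4 * x8) ^ 2 = 1) (c49 : (x4 * x9) ^ 2 = 1) (c4_10 : (x4 * x10) ^ 2 = 1)
    (c56 : (x5 * x6) ^ 2 = 1)
    (c68 : (x6 * x8) ^ 2 = 1) (c69 : (x6 * x9) ^ 2 = 1) (c6_10 : (x6 * x10) ^ 2 = 1)
    (c79 : (x7 * x9) ^ 2 = 1) (c7_10 : (x7 * x10) ^ 2 = 1)
    (c8_10 : (x8 * x10) ^ 2 = 1) :
    (x2 * x4) ^ 2 = 1 := by
  have k12 := braid_of_mul_pow_three_eq_one h1 h2 b12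
  have k14 := braid_of_mul_pow_three_eq_one h1 h4 b14
  have d13 := commute_of_mul_sq_eq_one h1 h3 c13
  have d34 := commute_of_mul_sq_eq_one h3 h4 c34
  have d15 := commute_of_mul_sq_eq_one h1 h5 c15
  have d16 := commute_of_mul_sq_eq_one h1 h6 c16
  have d17 := commute_of_mul_sq_eq_one h1 h7 c17
  have d18 := commute_of_mul_sq_eq_one h1 h8 c18
  have d19 := commute_of_mul_sq_eq_one h1 h9 c19
  have d110 := commute_of_mul_sq_eq_one h1 h10 c1_10
  have hR : Commute x1 (x4 * x3 * x2 * x1 * x2 * x3 * x4) := by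
    rw [hstar]
    repeat' apply Commute.mul_right
    all_goals assumption
  have hL : x4 * x3 * x2 * x1 * x2 * x3 * x4 = x4 * x1 * (x3 * x2 * x3) * x1 * x4 :=
    calc x4 * x3 * x2 * x1 * x2 * x3 * x4
        = x4 * x3 * (x2 * x1 * x2) * x3 * x4 := by simp only [mul_assoc]
      _ = x4 * (x3 * x1) * x2 * (x1 * x3) * x4 := by rw [← k12]; simp only [mul_assoc]
      _ = x4 * x1 * (x3 * x2 * x3) * x1 * x4 := by
        rw [← d13.eq, mul_assoc x4, mul_assoc x4]
        nth_rewrite 2 [d13.eq]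
        simp only [mul_assoc]
  rw [hL] at hR
  have h4L : Commute x4 (x3 * x2 * x3) := commute_of_commute_braid_conj h4 h1 k14.symm hR
  have h3sq : x3 * x3 = 1 := by rw [← sq, h3]
  have hx2 : x2 = x3 * (x3 * x2 * x3) * x3 := by
    rw [mul_assoc, mul_assoc (x3 * x2), h3sq, mul_one, ← mul_assoc, h3sq, one_mul]
  have d42 : Commute x4 x2 := by
    rw [hx2]
    exact (d34.symm.mul_right h4L).mul_right d34.symm
  rw [d42.symm.mul_pow, h2, h4, one_mul]
end

section
/- Let G be a group and let a, b, c, d, f ∈ G satisfy a² = b² = c² = d² = f² = e, (af)³ = e, (df)³ = e, (cd)³ = e, (bc)³ = e, (ad)² = e, (ac)² = e, (ab)² = e, (bd)² = e, (bf)² = e, and (cf)² = e. Then (a · (f d f c f d f b f d f c f d f))³ = e. -/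
theorem commute_of_sq_eq_one {G : Type*} [Group G] {x y : G}
    (hx : x * x = 1) (hy : y * y = 1) (hxy : (x * y) ^ 2 = 1) : x * y = y * x := by
  rw [pow_two] at hxy
  rw [eq_inv_of_mul_eq_one_left hxy, mul_inv_rev, inv_eq_of_mul_eq_one_left hx,
    inv_eq_of_mul_eq_one_left hy]

theorem braid_of_mul_pow_three_eq_one_s9 {G : Type*} [Group G] {x y : G}
    (hx : x * x = 1) (hy : y * y = 1) (hxy : (x * y) ^ 3 = 1) :
    x * y * x = y * x * y := by
  have h : x * y * x * (y * x * y) = 1 := by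
    simpa only [pow_succ, pow_zero, one_mul, mul_assoc] using hxy
  rw [eq_inv_of_mul_eq_one_left h]
  simp only [mul_inv_rev, inv_eq_of_mul_eq_one_left hx, inv_eq_of_mul_eq_one_left hy, mul_assoc]

/-- Redundancy of `⟨x_5, x_10 x_9 x_10 x_8 x_10 x_9 x_10 x_7 x_10 x_9 x_10 x_8 x_10 x_9 x_10⟩ = e`:
for involutions `a, b, c, d, f` with `(af)³ = (df)³ = (cd)³ = (bc)³ = e` and
`(ad)² = (ac)² = (ab)² = (bd)² = (bf)² = (cf)² = e`, one has
`(a (fdfcfdfbfdfcfdf))³ = e`. -/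
theorem braid_longest_conj_redundant {G : Type*} [Group G] (a b c d f : G)
    (ha : a ^ 2 = 1) (hb : b ^ 2 = 1) (hc : c ^ 2 = 1) (hd : d ^ 2 = 1)
    (hf : f ^ 2 = 1)
    (haf : (a * f) ^ 3 = 1) (hdf : (d * f) ^ 3 = 1) (hcd : (c * d) ^ 3 = 1)
    (hbc : (b * c) ^ 3 = 1)
    (had : (a * d) ^ 2 = 1) (hac : (a * c) ^ 2 = 1) (hab : (a * b) ^ 2 = 1)
    (hbd : (b * d) ^ 2 = 1) (hbf : (b * f) ^ 2 = 1) (hcf : (c * f) ^ 2 = 1) :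
    (a * (f * d * f * c * f * d * f * b * f * d * f * c * f * d * f)) ^ 3 = 1 := by
  rw [pow_two] at ha hb hc hd hf
  have braid_af := braid_of_mul_pow_three_eq_one_s9 ha hf haf
  have braid_cd := braid_of_mul_pow_three_eq_one_s9 hc hd hcd
  have braid_bc := braid_of_mul_pow_three_eq_one_s9 hb hc hbc
  have comm_ad := commute_of_sq_eq_one ha hd had
  have comm_ac := commute_of_sq_eq_one ha hc hac
  have comm_ab := commute_of_sq_eq_one ha hb hab
  have comm_bd := commute_of_sq_eq_one hb hd hbd
  have comm_bf := commute_of_sq_eq_one hb hf hbf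
  have comm_cf := commute_of_sq_eq_one hc hf hcf
  have hw : f * d * f * c * f * d * f = f * d * c * d * f := by
    calc f * d * f * c * f * d * f = f * d * (f * (c * f)) * d * f := by group
      _ = f * d * c * d * f := by rw [comm_cf, ← mul_assoc f f c, hf, one_mul]
  have hu : d * c * b * c * d = b * c * d * c * b := by
    calc d * c * b * c * d = d * (c * b * c) * d := by group
      _ = (d * b) * c * (b * d) := by rw [← braid_bc]; group
      _ = b * (d * c * d) * b := by rw [comm_bd]; nth_rw 1 [← comm_bd]; group
      _ = b * c * d * c * b := by rw [← braid_cd]; group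
  have ht : f * d * f * c * f * d * f * b * f * d * f * c * f * d * f
      = f * (b * c * d * c * b) * f := by
    calc f * d * f * c * f * d * f * b * f * d * f * c * f * d * f
        = (f * d * f * c * f * d * f) * b * (f * d * f * c * f * d * f) := by group
      _ = f * d * c * d * (f * b) * f * d * c * d * f := by rw [hw]; group
      _ = f * d * c * (d * b) * (f * f) * d * c * d * f := by rw [← comm_bf]; group
      _ = f * d * c * b * (d * d) * c * d * f := by rw [hf, ← comm_bd]; group
      _ = f * (d * c * b * c * d) * f := by rw [hd]; group
      _ = _ := by rw [hu]
  have hau : a * (b * c * d * c * b) = b * c * d * c * b * a :=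
    ((((Commute.mul_right comm_ab comm_ac).mul_right comm_ad).mul_right comm_ac).mul_right comm_ab :
      Commute a (b * c * d * c * b))
  have hfbc : f * (b * c) = b * c * f :=
    (Commute.mul_right comm_bf.symm comm_cf.symm : Commute f (b * c))
  have hinv : (f * a * b * c)⁻¹ = c * b * a * f := by
    simp only [mul_inv_rev, inv_eq_of_mul_eq_one_left ha, inv_eq_of_mul_eq_one_left hb,
      inv_eq_of_mul_eq_one_left hc, inv_eq_of_mul_eq_one_left hf, mul_assoc]
  have hconj : a * (f * (b * c * d * c * b) * f)
      = f * a * b * c * (d * f)⁻¹ * (f * a * b * c)⁻¹ := by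
    calc a * (f * (b * c * d * c * b) * f)
        = a * f * (a * a) * (b * c * d * c * b) * f := by rw [ha]; group
      _ = a * f * a * (a * (b * c * d * c * b)) * f := by group
      _ = f * a * (f * (b * c)) * d * c * b * a * f := by rw [braid_af, hau]; group
      _ = f * a * b * c * (f * d) * (c * b * a * f) := by rw [hfbc]; group
      _ = _ := by
        rw [hinv, mul_inv_rev, inv_eq_of_mul_eq_one_left hd, inv_eq_of_mul_eq_one_left hf]
  rw [ht, hconj, conj_pow, inv_pow, hdf, inv_one, mul_one, mul_inv_cancel]
end
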